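/- Assume T(𝓛) acts transitively on 𝓛, is imprimitive, and contains a long cycle (a cycle of length |𝓛|). Then there exist k ≥ 2, pairwise disjoint sets E₁, …, E_k ⊆ E, and collections 𝓛ᵢ of subsets of Eᵢ, such that 𝓛 = {X₁ ∪ ⋯ ∪ X_k : Xᵢ ∈ 𝓛ᵢ}, the group T(𝓛) is isomorphic to the direct product T(𝓛₁) × ⋯ × T(𝓛_k), each T(𝓛ᵢ) acts primitively on 𝓛ᵢ and contains a long cycle, |𝓛ᵢ| ≥ 2 for each i, the sizes |𝓛₁|, …, |𝓛_k| are pairwise coprime, and |𝓛| = |𝓛₁| ⋯ |𝓛_k|. -/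

import Mathlib

open scoped symmDiff

namespace TogglePaper

variable {E : Type*} [DecidableEq E]

/-- The toggle `τ_e` on the collection `L` of subsets of the ground set. -/
def toggle (L : Finset (Finset E)) (e : E) : Equiv.Perm {A : Finset E // A ∈ L} :=
  Function.Involutive.toPerm
    (fun X => if h : X.1 ∆ ({e} : Finset E) ∈ L then ⟨X.1 ∆ ({e} : Finset E), h⟩ else X)
    (by
      intro X
      by_cases h : X.1 ∆ ({e} : Finset E) ∈ L
      · have h2 : (X.1 ∆ ({e} : Finset E)) ∆ ({e} : Finset E) = X.1 :=
          symmDiff_symmDiff_cancel_right _ _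
        simp only [dif_pos h, h2]
        simp [h2, X.2]
      · simp [h])

/-- The generalized toggle group `T(L)`. -/
def toggleGroup (L : Finset (Finset E)) : Subgroup (Equiv.Perm {A : Finset E // A ∈ L}) :=
  Subgroup.closure (Set.range (toggle L))

/-- `T(L)` acts transitively on `L`. -/
def IsTransitive (L : Finset (Finset E)) : Prop :=
  ∀ A B : {A : Finset E // A ∈ L}, ∃ g ∈ toggleGroup L, g A = B

/-- `B` is a block for the action of `T(L)` on `L`. -/
def IsBlock (L : Finset (Finset E)) (B : Finset {A : Finset E // A ∈ L}) : Prop :=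
  ∀ g ∈ toggleGroup L, Finset.image g B = B ∨ Disjoint (Finset.image g B) B

/-- `Blocks` is a block system for `T(L)`: a partition of `L` into nonempty blocks
that is permuted by every element of `T(L)`. -/
def IsBlockSystem (L : Finset (Finset E))
    (Blocks : Finset (Finset {A : Finset E // A ∈ L})) : Prop :=
  (∀ B ∈ Blocks, B.Nonempty) ∧
  (∀ A : {A : Finset E // A ∈ L}, ∃! B : Finset {A : Finset E // A ∈ L},
      B ∈ Blocks ∧ A ∈ B) ∧
  (∀ g ∈ toggleGroup L, ∀ B ∈ Blocks, Finset.image g B ∈ Blocks)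

/-- An element `g` of `T(L)` is type 2 (with respect to a fixed block system `Blocks`)
if it maps each block to itself; it is type 1 otherwise. -/
def IsType2 (L : Finset (Finset E)) (Blocks : Finset (Finset {A : Finset E // A ∈ L}))
    (g : Equiv.Perm {A : Finset E // A ∈ L}) : Prop :=
  ∀ B ∈ Blocks, Finset.image g B = B

/-- The action of `T(L)` on `L` is primitive: it is transitive and the only blocks
are the singletons, the empty set and the whole set. -/
def IsPrimitive (L : Finset (Finset E)) : Prop :=
  IsTransitive L ∧
    ∀ B : Finset {A : Finset E // A ∈ L}, IsBlock L B → B.card ≤ 1 ∨ B = Finset.univ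

/-- `T(L)` contains a long cycle, i.e. a cycle whose support is all of `L`. -/
def HasLongCycle (L : Finset (Finset E)) : Prop :=
  ∃ g ∈ toggleGroup L, g.IsCycle ∧ g.support = Finset.univ

lemma toggle_val {L : Finset (Finset E)} {e : E} {X : {A : Finset E // A ∈ L}}
    (h : X.1 ∆ {e} ∈ L) : (toggle L e X).1 = X.1 ∆ {e} := by
  change (if h : X.1 ∆ {e} ∈ L then (⟨X.1 ∆ {e}, h⟩ : {A : Finset E // A ∈ L}) else X).1 = _
  rw [dif_pos h]

lemma toggle_of_notMem {L : Finset (Finset E)} {e : E} {X : {A : Finset E // A ∈ L}}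
    (h : X.1 ∆ {e} ∉ L) : toggle L e X = X := by
  change (if h : X.1 ∆ {e} ∈ L then (⟨X.1 ∆ {e}, h⟩ : {A : Finset E // A ∈ L}) else X) = _
  rw [dif_neg h]

@[simp]
lemma toggle_toggle (L : Finset (Finset E)) (e : E) (X : {A : Finset E // A ∈ L}) :
    toggle L e (toggle L e X) = X :=
  Function.Involutive.toPerm_involutive _ X

lemma toggle_mul_self (L : Finset (Finset E)) (e : E) : toggle L e * toggle L e = 1 :=
  Equiv.ext fun X => by simp

lemma toggle_mem (L : Finset (Finset E)) (e : E) : toggle L e ∈ toggleGroup L :=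
  Subgroup.subset_closure ⟨e, rfl⟩

/-- Along a transitive action, a property preserved by all toggles spreads to all of `L`. -/
lemma IsTransitive.spread {L : Finset (Finset E)} (hL : IsTransitive L)
    {P : {A : Finset E // A ∈ L} → Prop} (hP : ∀ e X, P X → P (toggle L e X))
    {X : {A : Finset E // A ∈ L}} (hX : P X) (Y : {A : Finset E // A ∈ L}) : P Y := by
  obtain ⟨g, hg, rfl⟩ := hL X Y
  have key : ∀ Z, P Z ↔ P (g Z) := by
    induction hg using Subgroup.closure_induction with
    | mem x hx =>
      obtain ⟨e, rfl⟩ := hx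
      exact fun Z => ⟨hP e Z, fun h => by simpa using hP e _ h⟩
    | one => simp
    | mul x y _ _ hx hy => exact fun Z => (hy Z).trans (hx (y Z))
    | inv x _ hx => exact fun Z => by simpa using (hx (x⁻¹ Z)).symm
  exact (key X).1 hX

/-- An equivalence relation on `L` preserved by every toggle. -/
def IsInvariant (L : Finset (Finset E)) (r : Setoid {A : Finset E // A ∈ L}) : Prop :=
  ∀ e X Y, r X Y → r (toggle L e X) (toggle L e Y)

/-- The relation of lying in the same translate of `B`. -/
def blockSetoid (L : Finset (Finset E)) (B : Finset {A : Finset E // A ∈ L}) :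
    Setoid {A : Finset E // A ∈ L} where
  r X Y := ∀ g ∈ toggleGroup L, g X ∈ B ↔ g Y ∈ B
  iseqv := ⟨fun _ _ _ => Iff.rfl, fun h g hg => (h g hg).symm,
    fun h h' g hg => (h g hg).trans (h' g hg)⟩

lemma blockSetoid_invariant (L : Finset (Finset E)) (B : Finset {A : Finset E // A ∈ L}) :
    IsInvariant L (blockSetoid L B) :=
  fun e _ _ h g hg => h (g * toggle L e) (mul_mem hg (toggle_mem L e))

lemma IsBlock.rel {L : Finset (Finset E)} {B : Finset {A : Finset E // A ∈ L}}
    (hB : IsBlock L B) {X Y : {A : Finset E // A ∈ L}} (hX : X ∈ B) (hY : Y ∈ B) :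
    blockSetoid L B X Y := by
  intro g hg
  rcases hB g hg with h | h
  · exact ⟨fun _ => h ▸ Finset.mem_image_of_mem g hY, fun _ => h ▸ Finset.mem_image_of_mem g hX⟩
  · exact ⟨fun h' => (Finset.disjoint_left.1 h (Finset.mem_image_of_mem g hX) h').elim,
      fun h' => (Finset.disjoint_left.1 h (Finset.mem_image_of_mem g hY) h').elim⟩

/-- A nontrivial block gives a nontrivial invariant equivalence relation. -/
lemma exists_invariant {L : Finset (Finset E)} {B : Finset {A : Finset E // A ∈ L}}
    (hB : IsBlock L B) (h1 : 1 < B.card) (hne : B ≠ Finset.univ) :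
    ∃ r, IsInvariant L r ∧ (∃ X Y, X ≠ Y ∧ r X Y) ∧ ∃ X Y, ¬ r X Y := by
  obtain ⟨X, hX, Y, hY, hXY⟩ := Finset.one_lt_card.1 h1
  obtain ⟨Z, hZ⟩ : ∃ Z, Z ∉ B := by
    by_contra! h
    exact hne (Finset.eq_univ_iff_forall.2 h)
  exact ⟨blockSetoid L B, blockSetoid_invariant L B, ⟨X, Y, hXY, hB.rel hX hY⟩, X, Z,
    fun h => hZ ((h 1 (one_mem _)).1 hX)⟩

section Invariant

variable {L : Finset (Finset E)} {r : Setoid {A : Finset E // A ∈ L}}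

/-- A toggle moving `X` out of its class moves the whole class. -/
lemma IsInvariant.mem_of_not_rel (hr : IsInvariant L r) {e : E}
    {X Y : {A : Finset E // A ∈ L}} (hXY : r X Y) (hX : ¬ r X (toggle L e X)) :
    Y.1 ∆ {e} ∈ L := by
  by_contra h
  have h1 := hr e X Y hXY
  rw [toggle_of_notMem h] at h1
  exact hX (r.trans hXY (r.symm h1))

/-- `e` labels an edge inside a class of `r`. -/
def IsInner (L : Finset (Finset E)) (r : Setoid {A : Finset E // A ∈ L}) (e : E) : Prop :=
  ∃ X, X.1 ∆ {e} ∈ L ∧ r X (toggle L e X)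

lemma mem_of_toggle_ne {e : E} {X : {A : Finset E // A ∈ L}} (h : toggle L e X ≠ X) :
    X.1 ∆ {e} ∈ L := by
  by_contra h'
  exact h (toggle_of_notMem h')

lemma mem_of_not_rel {e : E} {X : {A : Finset E // A ∈ L}} (h : ¬ r X (toggle L e X)) :
    X.1 ∆ {e} ∈ L :=
  mem_of_toggle_ne fun h' => h (by rw [h'])

/-- If `e` labels an edge inside one class, then `e` preserves every class. -/
lemma IsInner.rel (htrans : IsTransitive L) (hr : IsInvariant L r) {e : E} (he : IsInner L r e)
    (Y : {A : Finset E // A ∈ L}) : r Y (toggle L e Y) := by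
  obtain ⟨X, hX, hrX⟩ := he
  obtain ⟨Z, hYZ, hZ, hrZ⟩ : ∃ Z, r Y Z ∧ Z.1 ∆ {e} ∈ L ∧ r Z (toggle L e Z) := by
    refine htrans.spread (P := fun Y => ∃ Z, r Y Z ∧ Z.1 ∆ {e} ∈ L ∧ r Z (toggle L e Z))
      ?_ ⟨X, r.refl X, hX, hrX⟩ Y
    rintro f W ⟨Z, hWZ, hZ, hrZ⟩
    by_cases hW : r W (toggle L f W)
    · exact ⟨Z, r.trans (r.symm hW) hWZ, hZ, hrZ⟩
    have h1 := hr.mem_of_not_rel hWZ hW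
    have h2 := hr.mem_of_not_rel (r.trans hWZ hrZ) hW
    have h3 := toggle_val h1
    have h4 := toggle_val h2
    rw [toggle_val hZ, symmDiff_right_comm, ← h3] at h4
    have h5 : (toggle L f Z).1 ∆ {e} ∈ L := h4 ▸ (toggle L f (toggle L e Z)).2
    refine ⟨toggle L f Z, hr f _ _ hWZ, h5, ?_⟩
    have h6 : toggle L e (toggle L f Z) = toggle L f (toggle L e Z) :=
      Subtype.ext ((toggle_val h5).trans h4.symm)
    rw [h6]
    exact hr f _ _ hrZ
  exact r.trans hYZ (r.trans hrZ (r.symm (hr e _ _ hYZ)))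

/-- An element of the toggle group acts on each class by translation if there are no inner
edges. -/
lemma translate_of_forall_not_isInner (hr : IsInvariant L r) (h : ∀ e, ¬ IsInner L r e)
    {g : Equiv.Perm {A : Finset E // A ∈ L}} (hg : g ∈ toggleGroup L) :
    ∀ X Y, r X Y → r (g X) (g Y) ∧ (g X).1 ∆ X.1 = (g Y).1 ∆ Y.1 := by
  have base : ∀ (e : E) X Y, r X Y → r (toggle L e X) (toggle L e Y) ∧
      (toggle L e X).1 ∆ X.1 = (toggle L e Y).1 ∆ Y.1 := by
    intro e X Y hXY
    refine ⟨hr e X Y hXY, ?_⟩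
    by_cases hX : X.1 ∆ {e} ∈ L
    · have hY := hr.mem_of_not_rel hXY fun h' => h e ⟨X, hX, h'⟩
      rw [toggle_val hX, toggle_val hY]
      simp [symmDiff_comm]
    · by_cases hY : Y.1 ∆ {e} ∈ L
      · exact (hX (hr.mem_of_not_rel (r.symm hXY) fun h' => h e ⟨Y, hY, h'⟩)).elim
      · rw [toggle_of_notMem hX, toggle_of_notMem hY]
        simp
  induction hg using Subgroup.closure_induction'' with
  | one => simp
  | mem x hx =>
    obtain ⟨e, rfl⟩ := hx
    exact base e
  | inv_mem x hx =>
    obtain ⟨e, rfl⟩ := hx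
    rw [inv_eq_of_mul_eq_one_left (toggle_mul_self L e)]
    exact base e
  | mul x y _ _ hx hy =>
    intro X Y hXY
    obtain ⟨h1, h2⟩ := hy X Y hXY
    obtain ⟨h3, h4⟩ := hx _ _ h1
    refine ⟨h3, ?_⟩
    have key : ∀ A B C : Finset E, A ∆ C = (A ∆ B) ∆ (B ∆ C) := fun A B C => by
      rw [symmDiff_assoc, symmDiff_symmDiff_cancel_left]
    rw [Equiv.Perm.mul_apply, Equiv.Perm.mul_apply, key _ (y X).1, h4, h2, ← key]

/-- A toggle commuting with a fixed-point-free translation `h` by `S` is an even permutation,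
provided `S` contains an element other than the toggled one. -/
lemma sign_toggle_eq_one {e s : E} (hse : s ≠ e) {S : Finset E} (hs : s ∈ S)
    {h : Equiv.Perm {A : Finset E // A ∈ L}} (hS : ∀ Z, (h Z).1 = Z.1 ∆ S)
    (hcomm : ∀ Z, toggle L e (h Z) = h (toggle L e Z)) :
    Equiv.Perm.sign (toggle L e) = 1 := by
  have hmem : ∀ Z, s ∈ (toggle L e Z).1 ↔ s ∈ Z.1 := by
    intro Z
    by_cases hZ : Z.1 ∆ {e} ∈ L
    · rw [toggle_val hZ]
      simp [Finset.mem_symmDiff, hse]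
    · rw [toggle_of_notMem hZ]
  have hflip : ∀ Z, s ∈ (h Z).1 ↔ s ∉ Z.1 := by
    intro Z
    rw [hS]
    simp [Finset.mem_symmDiff, hs]
  have hh : ∀ Z, h (h Z) = Z := fun Z => Subtype.ext <| by
    rw [hS, hS, symmDiff_symmDiff_cancel_right]
  let σ : Equiv.Perm {A : Finset E // A ∈ L} :=
    Function.Involutive.toPerm (fun Z => if s ∈ Z.1 then toggle L e Z else Z) (by
      intro Z
      by_cases hZ : s ∈ Z.1 <;> simp [hZ, hmem])
  have hσ : ∀ Z, σ Z = if s ∈ Z.1 then toggle L e Z else Z := fun _ => rfl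
  have heq : toggle L e = σ * (h * σ * h) := by
    ext1 Z
    simp only [Equiv.Perm.mul_apply]
    by_cases hZ : s ∈ Z.1
    · rw [hσ (h Z), if_neg (by simp [hflip, hZ]), hh, hσ, if_pos hZ]
    · rw [hσ (h Z), if_pos (by simp [hflip, hZ]), hcomm, hh, hσ, if_neg (by simp [hmem, hZ])]
  rw [heq, map_mul, map_mul, map_mul]
  generalize Equiv.Perm.sign σ = a
  generalize Equiv.Perm.sign h = b
  rcases Int.units_eq_one_or a with rfl | rfl <;> rcases Int.units_eq_one_or b with rfl | rfl <;>
    rfl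

/-- If the toggle group contains a long cycle, every nontrivial invariant equivalence relation
has an inner edge. -/
lemma exists_isInner (hlong : HasLongCycle L) (hr : IsInvariant L r)
    {X Y : {A : Finset E // A ∈ L}} (hne : X ≠ Y) (hXY : r X Y) : ∃ e, IsInner L r e := by
  by_contra! hin
  obtain ⟨c, hc, hcyc, hsupp⟩ := hlong
  have hmove : ∀ Z, c Z ≠ Z := fun Z => by
    rw [← Equiv.Perm.mem_support, hsupp]
    exact Finset.mem_univ Z
  obtain ⟨i, hi⟩ := hcyc.exists_zpow_eq (hmove X) (hmove Y)
  set h := c ^ i with hh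
  have hS : ∀ Z, (h Z).1 = Z.1 ∆ (X.1 ∆ Y.1) ∧ r Z (h Z) := by
    intro Z
    obtain ⟨j, rfl⟩ := hcyc.exists_zpow_eq (hmove X) (hmove Z)
    obtain ⟨h1, h2⟩ := translate_of_forall_not_isInner hr hin (zpow_mem hc j) X Y hXY
    have h3 : h ((c ^ j) X) = (c ^ j) Y := by
      rw [← hi, hh, ← Equiv.Perm.mul_apply, ← Equiv.Perm.mul_apply, zpow_mul_comm]
    rw [h3]
    refine ⟨?_, h1⟩
    rw [← symmDiff_assoc, h2, symmDiff_symmDiff_cancel_right]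
  have hsq : h ^ 2 = 1 := by
    ext1 Z
    refine Subtype.ext ?_
    rw [sq, Equiv.Perm.mul_apply, (hS _).1, (hS _).1, symmDiff_symmDiff_cancel_right]
    rfl
  have hh1 : h ≠ 1 := fun h1 => hne (by rw [← hi, h1]; rfl)
  have heven : Even c.support.card := by
    rw [← hcyc.orderOf, even_iff_two_dvd, ← orderOf_eq_prime hsq hh1]
    exact orderOf_dvd_of_mem_zpowers ⟨i, rfl⟩
  have hsign : c ∈ (Equiv.Perm.sign (α := {A : Finset E // A ∈ L})).ker := by
    refine (Subgroup.closure_le _).2 ?_ hc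
    rintro _ ⟨e, rfl⟩
    obtain ⟨s, hs, hse⟩ : ∃ s ∈ X.1 ∆ Y.1, s ≠ e := by
      by_contra! hsub
      rcases Finset.subset_singleton_iff.1
        (fun s hs => Finset.mem_singleton.2 (hsub s hs)) with h0 | h0
      · exact hne (Subtype.ext (symmDiff_eq_bot.1 h0))
      · have h1 := hS X
        rw [h0] at h1
        have h2 : X.1 ∆ {e} ∈ L := h1.1 ▸ (h X).2
        have h3 : toggle L e X = h X := Subtype.ext ((toggle_val h2).trans h1.1.symm)
        exact hin e ⟨X, h2, h3 ▸ h1.2⟩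
    refine sign_toggle_eq_one hse hs (fun Z => (hS Z).1) fun Z => Subtype.ext ?_
    have h1 := (translate_of_forall_not_isInner hr hin (toggle_mem L e) Z (h Z) (hS Z).2).2
    have h2 : (toggle L e (h Z)).1 = (toggle L e Z).1 ∆ Z.1 ∆ (h Z).1 := by
      rw [h1, symmDiff_symmDiff_cancel_right]
    rw [h2, (hS (toggle L e Z)).1, (hS Z).1, symmDiff_assoc, symmDiff_symmDiff_cancel_left]
  have hodd := hcyc.sign
  rw [MonoidHom.mem_ker.1 hsign, heven.neg_one_pow] at hodd
  exact absurd hodd (by decide)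

lemma toggle_val_inter_of_notMem {e : E} {F : Finset E} (he : e ∉ F)
    (X : {A : Finset E // A ∈ L}) : (toggle L e X).1 ∩ F = X.1 ∩ F := by
  by_cases hX : X.1 ∆ {e} ∈ L
  · rw [toggle_val hX]
    ext a
    simp only [Finset.mem_inter, Finset.mem_symmDiff, Finset.mem_singleton]
    grind
  · rw [toggle_of_notMem hX]

lemma two_le_card_image_inter {e : E} {F : Finset E} (he : e ∈ F)
    {X : {A : Finset E // A ∈ L}} (hX : X.1 ∆ {e} ∈ L) : 2 ≤ (L.image (· ∩ F)).card := by
  refine Finset.one_lt_card.2 ⟨_, Finset.mem_image_of_mem _ X.2, _,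
    Finset.mem_image_of_mem _ hX, fun h => ?_⟩
  have := Finset.ext_iff.1 h e
  simp only [Finset.mem_inter, Finset.mem_symmDiff, Finset.mem_singleton] at this
  grind

/-- `L` consists of the unions of a member of `L₁` and a member of `L₂`, where `L₁` and `L₂` live
on disjoint ground sets. -/
structure IsProduct (L L₁ L₂ : Finset (Finset E)) (E₁ E₂ : Finset E) : Prop where
  disj : Disjoint E₁ E₂
  sub₁ : ∀ B ∈ L₁, B ⊆ E₁
  sub₂ : ∀ C ∈ L₂, C ⊆ E₂
  mem_iff : ∀ A, A ∈ L ↔ ∃ B ∈ L₁, ∃ C ∈ L₂, A = B ∪ C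

/-- If toggles at `E₁` commute with toggles at `E₂`, then `L` is a product. -/
lemma isProduct_of_commute (htrans : IsTransitive L) {E₁ E₂ : Finset E} (hdisj : Disjoint E₁ E₂)
    (hsub : ∀ X ∈ L, X ⊆ E₁ ∪ E₂)
    (hcomm : ∀ e ∈ E₁, ∀ f ∈ E₂, Commute (toggle L e) (toggle L f)) :
    IsProduct L (L.image (· ∩ E₁)) (L.image (· ∩ E₂)) E₁ E₂ where
  disj := hdisj
  sub₁ := by
    simp only [Finset.mem_image, forall_exists_index, and_imp]
    rintro _ X - rfl
    exact Finset.inter_subset_right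
  sub₂ := by
    simp only [Finset.mem_image, forall_exists_index, and_imp]
    rintro _ X - rfl
    exact Finset.inter_subset_right
  mem_iff := by
    intro A
    constructor
    · intro hA
      refine ⟨_, Finset.mem_image_of_mem _ hA, _, Finset.mem_image_of_mem _ hA, ?_⟩
      rw [← Finset.inter_union_distrib_left, Finset.inter_eq_left.2 (hsub A hA)]
    · rintro ⟨_, hB, _, hC, rfl⟩
      obtain ⟨X, hX, rfl⟩ := Finset.mem_image.1 hB
      obtain ⟨Y, hY, rfl⟩ := Finset.mem_image.1 hC
      let T : Subgroup (Equiv.Perm {A : Finset E // A ∈ L}) :=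
        Subgroup.closure (toggle L '' (E₁ : Set E))
      have hT : ∀ g ∈ T, ∀ f ∈ E₂, Commute g (toggle L f) := by
        intro g hg f hf
        have hle : T ≤ Subgroup.centralizer {toggle L f} := by
          refine (Subgroup.closure_le _).2 ?_
          rintro _ ⟨e, he, rfl⟩
          exact Subgroup.mem_centralizer_singleton_iff.2 (hcomm e he f hf)
        exact Subgroup.mem_centralizer_singleton_iff.1 (hle hg)
      obtain ⟨Z, h1, h2, -⟩ : ∃ Z : {A : Finset E // A ∈ L}, Z.1 ∩ E₁ = X ∩ E₁ ∧
          Z.1 ∩ E₂ = Y ∩ E₂ ∧ ∃ g ∈ T, Z = g ⟨Y, hY⟩ := by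
        refine htrans.spread (P := fun Y => ∃ Z : {A : Finset E // A ∈ L}, Z.1 ∩ E₁ = X ∩ E₁ ∧
          Z.1 ∩ E₂ = Y.1 ∩ E₂ ∧ ∃ g ∈ T, Z = g Y) ?_ (X := ⟨X, hX⟩)
          ⟨⟨X, hX⟩, rfl, rfl, 1, one_mem _, rfl⟩ ⟨Y, hY⟩
        rintro e W ⟨Z, h1, h2, g, hg, rfl⟩
        by_cases he₁ : e ∈ E₁
        · refine ⟨g W, h1, ?_, g * toggle L e,
            mul_mem hg (Subgroup.subset_closure ⟨e, he₁, rfl⟩), by simp⟩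
          rw [toggle_val_inter_of_notMem (Finset.disjoint_left.1 hdisj he₁), h2]
        by_cases hW : toggle L e W = W
        · rw [hW]
          exact ⟨g W, h1, h2, g, hg, rfl⟩
        have hWe := mem_of_toggle_ne hW
        have he₂ : e ∈ E₂ := by
          have h3 := hsub _ W.2
          have h4 := hsub _ hWe
          have h5 : e ∈ E₁ ∪ E₂ := by
            by_cases h6 : e ∈ W.1
            · exact h3 h6
            · exact h4 (by simp [Finset.mem_symmDiff, h6])
          exact (Finset.mem_union.1 h5).resolve_left he₁
        have hc : toggle L e (g W) = g (toggle L e W) :=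
          (DFunLike.congr_fun (hT g hg e he₂) W).symm
        have hge : (g W).1 ∆ {e} ∈ L := mem_of_toggle_ne fun h => hW (g.injective (hc ▸ h))
        refine ⟨toggle L e (g W), ?_, ?_, g, hg, hc⟩
        · rw [toggle_val_inter_of_notMem he₁, h1]
        · rw [toggle_val hge, toggle_val hWe]
          ext a
          have := Finset.ext_iff.1 h2 a
          simp only [Finset.mem_inter, Finset.mem_symmDiff, Finset.mem_singleton] at this ⊢
          grind
      rw [← h1, ← h2, ← Finset.inter_union_distrib_left, Finset.inter_eq_left.2 (hsub _ Z.2)]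
      exact Z.2

lemma IsInvariant.mem_iff_of_rel (hr : IsInvariant L r) {e : E} (he : ¬ IsInner L r e)
    {X Y : {A : Finset E // A ∈ L}} (hXY : r X Y) : X.1 ∆ {e} ∈ L ↔ Y.1 ∆ {e} ∈ L :=
  ⟨fun h => hr.mem_of_not_rel hXY fun h' => he ⟨X, h, h'⟩,
    fun h => hr.mem_of_not_rel (r.symm hXY) fun h' => he ⟨Y, h, h'⟩⟩

lemma commute_toggle (htrans : IsTransitive L) (hr : IsInvariant L r) {e f : E}
    (he : ¬ IsInner L r e) (hf : IsInner L r f) : Commute (toggle L e) (toggle L f) := by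
  have hmem : ∀ Z, Z.1 ∆ {e} ∈ L ↔ (toggle L f Z).1 ∆ {e} ∈ L := fun Z =>
    hr.mem_iff_of_rel he (hf.rel htrans hr Z)
  ext1 X
  simp only [Equiv.Perm.mul_apply]
  by_cases hX : X.1 ∆ {e} ∈ L
  · have hfX := (hmem X).1 hX
    have hiff : X.1 ∆ {f} ∈ L ↔ (toggle L e X).1 ∆ {f} ∈ L := by
      rw [toggle_val hX]
      constructor
      · intro h
        rw [symmDiff_right_comm, ← toggle_val h]
        exact hfX
      · intro h
        rw [← toggle_val hX] at h
        have h1 := (hmem (toggle L e X)).1 (by rw [toggle_val hX]; simp)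
        rwa [toggle_val h, toggle_val hX, symmDiff_right_comm, symmDiff_symmDiff_cancel_right]
          at h1
    refine Subtype.ext ?_
    by_cases h : X.1 ∆ {f} ∈ L
    · rw [toggle_val hfX, toggle_val h, toggle_val (hiff.1 h), toggle_val hX, symmDiff_right_comm]
    · rw [toggle_val hfX, toggle_of_notMem h, toggle_of_notMem (mt hiff.2 h), toggle_val hX]
  · rw [toggle_of_notMem hX, toggle_of_notMem (mt (hmem X).2 hX)]

/-- A nontrivial invariant equivalence relation on a transitive toggle group with a long cycle
splits `L` as a product of two nontrivial collections. -/
lemma exists_isProduct (htrans : IsTransitive L) (hlong : HasLongCycle L)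
    (hr : IsInvariant L r) (hne : ∃ X Y, X ≠ Y ∧ r X Y) (hnr : ∃ X Y, ¬ r X Y) {U : Finset E}
    (hU : ∀ X ∈ L, X ⊆ U) :
    ∃ L₁ L₂ E₁ E₂, IsProduct L L₁ L₂ E₁ E₂ ∧ E₁ ⊆ U ∧ E₂ ⊆ U ∧ 2 ≤ L₁.card ∧ 2 ≤ L₂.card := by
  classical
  obtain ⟨X, Y, hXY, hrXY⟩ := hne
  obtain ⟨A, B, hAB⟩ := hnr
  have hmemU : ∀ (Z : {A : Finset E // A ∈ L}) e, Z.1 ∆ {e} ∈ L → e ∈ U := by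
    intro Z e hZ
    by_cases h : e ∈ Z.1
    · exact hU _ Z.2 h
    · exact hU _ hZ (by simp [Finset.mem_symmDiff, h])
  refine ⟨_, _, U.filter fun e => ¬ IsInner L r e, U.filter fun e => IsInner L r e,
    isProduct_of_commute htrans (Finset.disjoint_filter_filter_not U U _).symm ?_ ?_,
    Finset.filter_subset _ _, Finset.filter_subset _ _, ?_, ?_⟩
  · intro Z hZ
    rw [Finset.union_comm, Finset.filter_union_filter_not_eq]
    exact hU Z hZ
  · intro e he f hf
    exact commute_toggle htrans hr (Finset.mem_filter.1 he).2 (Finset.mem_filter.1 hf).2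
  · obtain ⟨e, Z, hZ⟩ : ∃ e Z, ¬ r Z (toggle L e Z) := by
      by_contra! h
      exact hAB (htrans.spread (P := fun Z => r A Z) (fun e Z hZ => r.trans hZ (h e Z))
        (r.refl A) B)
    have hZe := mem_of_not_rel hZ
    exact two_le_card_image_inter (Finset.mem_filter.2
      ⟨hmemU Z e hZe, fun h => hZ (h.rel htrans hr Z)⟩) hZe
  · obtain ⟨e, he⟩ := exists_isInner hlong hr hXY hrXY
    obtain ⟨Z, hZ, -⟩ := id he
    exact two_le_card_image_inter (Finset.mem_filter.2 ⟨hmemU Z e hZ, he⟩) hZ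

end Invariant

lemma toggle_eq_self_of_notMem {L : Finset (Finset E)} {F : Finset E} (hF : ∀ X ∈ L, X ⊆ F)
    {e : E} (he : e ∉ F) (X : {A : Finset E // A ∈ L}) : toggle L e X = X := by
  refine toggle_of_notMem fun h => he ?_
  by_cases h' : e ∈ X.1
  · exact hF _ X.2 h'
  · exact hF _ h (by simp [Finset.mem_symmDiff, h'])

/-- A permutation of at least two points moving any point to any other by its powers is a cycle
of full support. -/
lemma isCycle_of_pretransitive {α : Type*} [Fintype α] [DecidableEq α] [Nontrivial α]
    {c : Equiv.Perm α} (h : ∀ x y, ∃ i : ℤ, (c ^ i) x = y) :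
    c.IsCycle ∧ c.support = Finset.univ := by
  have hmove : ∀ x, c x ≠ x := by
    intro x hx
    obtain ⟨y, hy⟩ := exists_ne x
    obtain ⟨i, hi⟩ := h x y
    rw [Equiv.Perm.zpow_apply_eq_self_of_apply_eq_self hx] at hi
    exact hy hi.symm
  obtain ⟨x⟩ := (inferInstance : Nonempty α)
  refine ⟨⟨x, hmove _, fun y _ => h _ y⟩, ?_⟩
  ext y
  simp [hmove]

namespace IsProduct

variable {L L₁ L₂ : Finset (Finset E)} {E₁ E₂ : Finset E}

lemma symm (h : IsProduct L L₁ L₂ E₁ E₂) : IsProduct L L₂ L₁ E₂ E₁ where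
  disj := h.disj.symm
  sub₁ := h.sub₂
  sub₂ := h.sub₁
  mem_iff A := by
    rw [h.mem_iff]
    constructor
    · rintro ⟨B, hB, C, hC, rfl⟩
      exact ⟨C, hC, B, hB, Finset.union_comm _ _⟩
    · rintro ⟨B, hB, C, hC, rfl⟩
      exact ⟨C, hC, B, hB, Finset.union_comm _ _⟩

lemma union_inter_left (h : IsProduct L L₁ L₂ E₁ E₂) {B C : Finset E} (hB : B ⊆ E₁)
    (hC : C ⊆ E₂) : (B ∪ C) ∩ E₁ = B := by
  rw [Finset.union_inter_distrib_right, Finset.inter_eq_left.2 hB,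
    Finset.disjoint_iff_inter_eq_empty.1 (h.disj.symm.mono_left hC), Finset.union_empty]

lemma union_inter_right (h : IsProduct L L₁ L₂ E₁ E₂) {B C : Finset E} (hB : B ⊆ E₁)
    (hC : C ⊆ E₂) : (B ∪ C) ∩ E₂ = C := by
  rw [Finset.union_comm, h.symm.union_inter_left hC hB]

lemma union_mem_iff (h : IsProduct L L₁ L₂ E₁ E₂) {B C : Finset E} (hB : B ⊆ E₁)
    (hC : C ⊆ E₂) : B ∪ C ∈ L ↔ B ∈ L₁ ∧ C ∈ L₂ := by
  rw [h.mem_iff]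
  constructor
  · rintro ⟨B', hB', C', hC', heq⟩
    have h1 := h.union_inter_left hB hC
    have h2 := h.union_inter_right hB hC
    rw [heq, h.union_inter_left (h.sub₁ _ hB') (h.sub₂ _ hC')] at h1
    rw [heq, h.union_inter_right (h.sub₁ _ hB') (h.sub₂ _ hC')] at h2
    exact ⟨h1 ▸ hB', h2 ▸ hC'⟩
  · rintro ⟨hB', hC'⟩
    exact ⟨B, hB', C, hC', rfl⟩

/-- The bijection `L₁ × L₂ ≃ L` given by union. -/
noncomputable def equiv (h : IsProduct L L₁ L₂ E₁ E₂) :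
    {A : Finset E // A ∈ L₁} × {A : Finset E // A ∈ L₂} ≃ {A : Finset E // A ∈ L} :=
  Equiv.ofBijective (fun p => ⟨p.1.1 ∪ p.2.1, (h.mem_iff _).2 ⟨_, p.1.2, _, p.2.2, rfl⟩⟩) (by
    constructor
    · rintro ⟨B, C⟩ ⟨B', C'⟩ heq
      have heq' : B.1 ∪ C.1 = B'.1 ∪ C'.1 := congrArg Subtype.val heq
      have h1 := h.union_inter_left (h.sub₁ _ B.2) (h.sub₂ _ C.2)
      have h2 := h.union_inter_right (h.sub₁ _ B.2) (h.sub₂ _ C.2)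
      rw [heq', h.union_inter_left (h.sub₁ _ B'.2) (h.sub₂ _ C'.2)] at h1
      rw [heq', h.union_inter_right (h.sub₁ _ B'.2) (h.sub₂ _ C'.2)] at h2
      exact Prod.ext (Subtype.ext h1.symm) (Subtype.ext h2.symm)
    · rintro ⟨A, hA⟩
      obtain ⟨B, hB, C, hC, rfl⟩ := (h.mem_iff A).1 hA
      exact ⟨(⟨B, hB⟩, ⟨C, hC⟩), rfl⟩)

lemma equiv_val (h : IsProduct L L₁ L₂ E₁ E₂)
    (p : {A : Finset E // A ∈ L₁} × {A : Finset E // A ∈ L₂}) :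
    (h.equiv p).1 = p.1.1 ∪ p.2.1 := rfl

lemma card_eq (h : IsProduct L L₁ L₂ E₁ E₂) : L.card = L₁.card * L₂.card := by
  simpa using (Fintype.card_congr h.equiv).symm

/-- Pairs of permutations acting coordinatewise on `L`. -/
noncomputable def permHom (h : IsProduct L L₁ L₂ E₁ E₂) :
    Equiv.Perm {A : Finset E // A ∈ L₁} × Equiv.Perm {A : Finset E // A ∈ L₂} →*
      Equiv.Perm {A : Finset E // A ∈ L} where
  toFun p := h.equiv.permCongr (Equiv.prodCongr p.1 p.2)
  map_one' := by ext1 X; simp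
  map_mul' p q := by
    ext1 X
    simp
    rfl

lemma permHom_apply (h : IsProduct L L₁ L₂ E₁ E₂)
    (p : Equiv.Perm {A : Finset E // A ∈ L₁} × Equiv.Perm {A : Finset E // A ∈ L₂}) (B C) :
    h.permHom p (h.equiv (B, C)) = h.equiv (p.1 B, p.2 C) := by
  simp [permHom]

lemma permHom_injective (h : IsProduct L L₁ L₂ E₁ E₂) (h₁ : L₁.Nonempty) (h₂ : L₂.Nonempty) :
    Function.Injective h.permHom := by
  obtain ⟨B₀, hB₀⟩ := h₁
  obtain ⟨C₀, hC₀⟩ := h₂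
  intro p q hpq
  have key : ∀ B C, (p.1 B, p.2 C) = (q.1 B, q.2 C) := fun B C =>
    h.equiv.injective (by rw [← permHom_apply, ← permHom_apply, hpq])
  exact Prod.ext (Equiv.ext fun B => congrArg Prod.fst (key B ⟨C₀, hC₀⟩))
    (Equiv.ext fun C => congrArg Prod.snd (key ⟨B₀, hB₀⟩ C))

lemma toggle_union (h : IsProduct L L₁ L₂ E₁ E₂) {e : E} (he : e ∈ E₁)
    {X : {A : Finset E // A ∈ L}} {B : {A : Finset E // A ∈ L₁}} {C : {A : Finset E // A ∈ L₂}}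
    (hX : X.1 = B.1 ∪ C.1) : (toggle L e X).1 = (toggle L₁ e B).1 ∪ C.1 := by
  have heC : e ∉ C.1 := fun h' => Finset.disjoint_left.1 h.disj he (h.sub₂ _ C.2 h')
  have hsym : X.1 ∆ {e} = B.1 ∆ {e} ∪ C.1 := by
    rw [hX]
    ext a
    simp only [Finset.mem_union, Finset.mem_symmDiff, Finset.mem_singleton]
    grind
  have hsub : B.1 ∆ {e} ⊆ E₁ := by
    intro a ha
    rcases Finset.mem_symmDiff.1 ha with h' | h'
    · exact h.sub₁ _ B.2 h'.1
    · exact Finset.mem_singleton.1 h'.1 ▸ he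
  have hiff : X.1 ∆ {e} ∈ L ↔ B.1 ∆ {e} ∈ L₁ := by
    rw [hsym, h.union_mem_iff hsub (h.sub₂ _ C.2)]
    exact and_iff_left C.2
  by_cases hB : B.1 ∆ {e} ∈ L₁
  · rw [toggle_val hB, toggle_val (hiff.2 hB), hsym]
  · rw [toggle_of_notMem hB, toggle_of_notMem (mt hiff.1 hB), hX]

lemma permHom_toggle (h : IsProduct L L₁ L₂ E₁ E₂) (e : E) :
    h.permHom (toggle L₁ e, toggle L₂ e) = toggle L e := by
  ext1 X
  obtain ⟨⟨B, C⟩, rfl⟩ := h.equiv.surjective X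
  refine Subtype.ext ?_
  rw [permHom_apply, equiv_val]
  by_cases h₁ : e ∈ E₁
  · rw [toggle_eq_self_of_notMem h.sub₂ (Finset.disjoint_left.1 h.disj h₁),
      h.toggle_union h₁ (h.equiv_val (B, C))]
  rw [toggle_eq_self_of_notMem h.sub₁ h₁]
  by_cases h₂ : e ∈ E₂
  · rw [h.symm.toggle_union h₂ ((h.equiv_val (B, C)).trans (Finset.union_comm _ _)),
      Finset.union_comm]
  · have hsub : ∀ X ∈ L, X ⊆ E₁ ∪ E₂ := by
      intro X hX
      obtain ⟨B, hB, C, hC, rfl⟩ := (h.mem_iff X).1 hX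
      exact Finset.union_subset_union (h.sub₁ _ hB) (h.sub₂ _ hC)
    rw [toggle_eq_self_of_notMem h.sub₂ h₂, toggle_eq_self_of_notMem hsub (by simp [h₁, h₂]),
      equiv_val]

lemma map_prod_toggleGroup (h : IsProduct L L₁ L₂ E₁ E₂) :
    ((toggleGroup L₁).prod (toggleGroup L₂)).map h.permHom = toggleGroup L := by
  apply le_antisymm
  · rw [Subgroup.map_le_iff_le_comap, Subgroup.prod_le_iff]
    have key : ∀ e, h.permHom (toggle L₁ e, 1) ∈ toggleGroup L ∧
        h.permHom (1, toggle L₂ e) ∈ toggleGroup L := by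
      intro e
      have h0 : h.permHom (1, 1) ∈ toggleGroup L := by
        rw [← Prod.one_eq_mk, map_one]
        exact one_mem _
      have h1 := toggle_mem L e
      rw [← h.permHom_toggle] at h1
      by_cases h₁ : e ∈ E₁
      · have h2 : toggle L₂ e = 1 := Equiv.ext fun X =>
          toggle_eq_self_of_notMem h.sub₂ (Finset.disjoint_left.1 h.disj h₁) X
        rw [h2] at h1 ⊢
        exact ⟨h1, h0⟩
      · have h2 : toggle L₁ e = 1 := Equiv.ext fun X => toggle_eq_self_of_notMem h.sub₁ h₁ X
        rw [h2] at h1 ⊢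
        exact ⟨h0, h1⟩
    constructor
    · rw [toggleGroup, Subgroup.map_le_iff_le_comap, Subgroup.closure_le]
      rintro _ ⟨e, rfl⟩
      exact (key e).1
    · rw [toggleGroup, Subgroup.map_le_iff_le_comap, Subgroup.closure_le]
      rintro _ ⟨e, rfl⟩
      exact (key e).2
  · refine (Subgroup.closure_le _).2 ?_
    rintro _ ⟨e, rfl⟩
    exact ⟨_, ⟨toggle_mem L₁ e, toggle_mem L₂ e⟩, h.permHom_toggle e⟩

/-- The toggle group of a product is the product of the toggle groups. -/
lemma nonempty_mulEquiv (h : IsProduct L L₁ L₂ E₁ E₂) (h₁ : L₁.Nonempty) (h₂ : L₂.Nonempty) :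
    Nonempty (toggleGroup L ≃* toggleGroup L₁ × toggleGroup L₂) :=
  ⟨(MulEquiv.subgroupCongr h.map_prod_toggleGroup.symm).trans
    ((Subgroup.equivMapOfInjective _ _ (h.permHom_injective h₁ h₂)).symm.trans
      (Subgroup.prodEquiv _ _))⟩

lemma exists_permHom_eq (h : IsProduct L L₁ L₂ E₁ E₂)
    {g : Equiv.Perm {A : Finset E // A ∈ L}} (hg : g ∈ toggleGroup L) :
    ∃ g₁ ∈ toggleGroup L₁, ∃ g₂ ∈ toggleGroup L₂, h.permHom (g₁, g₂) = g := by
  rw [← h.map_prod_toggleGroup] at hg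
  obtain ⟨⟨g₁, g₂⟩, ⟨h₁, h₂⟩, rfl⟩ := hg
  exact ⟨g₁, h₁, g₂, h₂, rfl⟩

lemma isTransitive_left (h : IsProduct L L₁ L₂ E₁ E₂) (h₂ : L₂.Nonempty)
    (htrans : IsTransitive L) : IsTransitive L₁ := by
  obtain ⟨C, hC⟩ := h₂
  intro A B
  obtain ⟨g, hg, hgA⟩ := htrans (h.equiv (A, ⟨C, hC⟩)) (h.equiv (B, ⟨C, hC⟩))
  obtain ⟨g₁, h₁, g₂, -, rfl⟩ := h.exists_permHom_eq hg
  rw [permHom_apply] at hgA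
  exact ⟨g₁, h₁, congrArg Prod.fst (h.equiv.injective hgA)⟩

/-- The components of a long cycle in a product are long cycles of coprime lengths. -/
lemma hasLongCycle_and_coprime (h : IsProduct L L₁ L₂ E₁ E₂) (h₁ : 2 ≤ L₁.card)
    (h₂ : 2 ≤ L₂.card) (hlong : HasLongCycle L) :
    HasLongCycle L₁ ∧ HasLongCycle L₂ ∧ Nat.Coprime L₁.card L₂.card := by
  have hnt : ∀ M : Finset (Finset E), 2 ≤ M.card → Nontrivial {A : Finset E // A ∈ M} := by
    intro M hM
    rw [← Fintype.one_lt_card_iff_nontrivial, Fintype.card_coe]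
    exact hM
  have := hnt _ h₁
  have := hnt _ h₂
  obtain ⟨c, hc, hcyc, hsupp⟩ := hlong
  have hmove : ∀ X, c X ≠ X := fun X => by
    rw [← Equiv.Perm.mem_support, hsupp]
    exact Finset.mem_univ X
  have hord : orderOf c = L₁.card * L₂.card := by
    rw [hcyc.orderOf, hsupp, Finset.card_univ, Fintype.card_coe, h.card_eq]
  obtain ⟨c₁, hc₁, c₂, hc₂, rfl⟩ := h.exists_permHom_eq hc
  have hpow : ∀ A B C D, ∃ i : ℤ, (c₁ ^ i) A = B ∧ (c₂ ^ i) C = D := by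
    intro A B C D
    obtain ⟨i, hi⟩ := hcyc.exists_zpow_eq (hmove (h.equiv (A, C))) (hmove (h.equiv (B, D)))
    rw [← map_zpow, permHom_apply] at hi
    have := h.equiv.injective hi
    exact ⟨i, congrArg Prod.fst this, congrArg Prod.snd this⟩
  obtain ⟨X⟩ := (inferInstance : Nonempty {A : Finset E // A ∈ L₁})
  obtain ⟨Y⟩ := (inferInstance : Nonempty {A : Finset E // A ∈ L₂})
  obtain ⟨hcyc₁, hsupp₁⟩ := isCycle_of_pretransitive (c := c₁) fun A B =>
    (hpow A B Y Y).imp fun _ => And.left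
  obtain ⟨hcyc₂, hsupp₂⟩ := isCycle_of_pretransitive (c := c₂) fun C D =>
    (hpow X X C D).imp fun _ => And.right
  refine ⟨⟨c₁, hc₁, hcyc₁, hsupp₁⟩, ⟨c₂, hc₂, hcyc₂, hsupp₂⟩, ?_⟩
  rw [orderOf_injective _ (h.permHom_injective ⟨_, X.2⟩ ⟨_, Y.2⟩), Prod.orderOf_mk, hcyc₁.orderOf,
    hcyc₂.orderOf, hsupp₁, hsupp₂, Finset.card_univ, Finset.card_univ, Fintype.card_coe,
    Fintype.card_coe] at hord
  have hgl := Nat.gcd_mul_lcm L₁.card L₂.card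
  rw [hord] at hgl
  exact Nat.eq_of_mul_eq_mul_right (Nat.mul_pos (by omega) (by omega)) (hgl.trans (one_mul _).symm)

end IsProduct

/-- A decomposition of `L` into primitive factors, with ground sets inside `U`. -/
structure IsFactorization {ι : Type} [Fintype ι] (L : Finset (Finset E)) (U : Finset E)
    (Es : ι → Finset E) (Ls : ι → Finset (Finset E)) : Prop where
  subset : ∀ i, Es i ⊆ U
  disj : ∀ i j, i ≠ j → Disjoint (Es i) (Es j)
  sub : ∀ i, ∀ X ∈ Ls i, X ⊆ Es i
  mem_iff : ∀ A : Finset E, A ∈ L ↔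
    ∃ f : ι → Finset E, (∀ i, f i ∈ Ls i) ∧ A = Finset.univ.sup f
  iso : Nonempty (toggleGroup L ≃* ((i : ι) → toggleGroup (Ls i)))
  prim : ∀ i, IsPrimitive (Ls i)
  long : ∀ i, HasLongCycle (Ls i)
  two_le : ∀ i, 2 ≤ (Ls i).card
  coprime : ∀ i j, i ≠ j → Nat.Coprime (Ls i).card (Ls j).card
  card : L.card = ∏ i, (Ls i).card

namespace IsFactorization

variable {ι κ : Type} [Fintype ι] [Fintype κ] {L L₁ L₂ : Finset (Finset E)} {U E₁ E₂ : Finset E}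

lemma reindex {Es : ι → Finset E} {Ls : ι → Finset (Finset E)} (h : IsFactorization L U Es Ls)
    (e : κ ≃ ι) : IsFactorization L U (Es ∘ e) (Ls ∘ e) where
  subset i := h.subset (e i)
  disj i j hij := h.disj _ _ (e.injective.ne hij)
  sub i := h.sub (e i)
  mem_iff A := by
    rw [h.mem_iff]
    constructor
    · rintro ⟨f, hf, rfl⟩
      refine ⟨f ∘ e, fun i => hf (e i), ?_⟩
      ext a
      simp [Finset.mem_sup, e.surjective.exists]
    · rintro ⟨f, hf, rfl⟩
      refine ⟨f ∘ e.symm, fun i => by simpa using hf (e.symm i), ?_⟩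
      ext a
      simp [Finset.mem_sup, e.surjective.exists]
  iso := by
    obtain ⟨φ⟩ := h.iso
    exact ⟨φ.trans
      { (Equiv.piCongrLeft (fun i => toggleGroup (Ls i)) e).symm with
        map_mul' := fun _ _ => rfl }⟩
  prim i := h.prim (e i)
  long i := h.long (e i)
  two_le i := h.two_le (e i)
  coprime i j hij := h.coprime _ _ (e.injective.ne hij)
  card := h.card.trans (e.prod_comp fun i => (Ls i).card).symm

lemma of_isPrimitive (hprim : IsPrimitive L) (hlong : HasLongCycle L) (hcard : 2 ≤ L.card)
    (hU : ∀ X ∈ L, X ⊆ U) : IsFactorization (ι := Unit) L U (fun _ => U) (fun _ => L) where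
  subset _ := subset_rfl
  disj i j hij := (hij (Subsingleton.elim i j)).elim
  sub _ := hU
  mem_iff A := by
    constructor
    · exact fun hA => ⟨fun _ => A, fun _ => hA, by simp⟩
    · rintro ⟨f, hf, rfl⟩
      simpa using hf ()
  iso := ⟨(MulEquiv.funUnique Unit (toggleGroup L)).symm⟩
  prim _ := hprim
  long _ := hlong
  two_le _ := hcard
  coprime i j hij := (hij (Subsingleton.elim i j)).elim
  card := by simp

/-- Factorizations of the two factors of a product combine. -/
lemma sum (hP : IsProduct L L₁ L₂ E₁ E₂) (h₁U : E₁ ⊆ U) (h₂U : E₂ ⊆ U)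
    (h₁ : L₁.Nonempty) (h₂ : L₂.Nonempty) (hcop : Nat.Coprime L₁.card L₂.card)
    {Es₁ : ι → Finset E} {Ls₁ : ι → Finset (Finset E)} (F₁ : IsFactorization L₁ E₁ Es₁ Ls₁)
    {Es₂ : κ → Finset E} {Ls₂ : κ → Finset (Finset E)} (F₂ : IsFactorization L₂ E₂ Es₂ Ls₂) :
    IsFactorization L U (Sum.elim Es₁ Es₂) (Sum.elim Ls₁ Ls₂) where
  subset := Sum.rec (fun i => (F₁.subset i).trans h₁U) (fun i => (F₂.subset i).trans h₂U)
  disj := by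
    have hcross : ∀ i j, Disjoint (Es₁ i) (Es₂ j) := fun i j =>
      Finset.disjoint_of_subset_left (F₁.subset i)
        (Finset.disjoint_of_subset_right (F₂.subset j) hP.disj)
    rintro (i | i) (j | j) hij
    · exact F₁.disj i j fun h => hij (h ▸ rfl)
    · exact hcross i j
    · exact (hcross j i).symm
    · exact F₂.disj i j fun h => hij (h ▸ rfl)
  sub := Sum.rec F₁.sub F₂.sub
  mem_iff A := by
    rw [hP.mem_iff]
    constructor
    · rintro ⟨B, hB, C, hC, rfl⟩
      obtain ⟨f, hf, rfl⟩ := (F₁.mem_iff B).1 hB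
      obtain ⟨g, hg, rfl⟩ := (F₂.mem_iff C).1 hC
      refine ⟨Sum.elim f g, Sum.rec hf hg, ?_⟩
      ext a
      simp [Finset.mem_sup]
    · rintro ⟨f, hf, rfl⟩
      refine ⟨_, (F₁.mem_iff _).2 ⟨f ∘ Sum.inl, fun i => hf (.inl i), rfl⟩,
        _, (F₂.mem_iff _).2 ⟨f ∘ Sum.inr, fun i => hf (.inr i), rfl⟩, ?_⟩
      ext a
      simp [Finset.mem_sup]
  iso := by
    obtain ⟨φ₁⟩ := F₁.iso
    obtain ⟨φ₂⟩ := F₂.iso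
    obtain ⟨φ⟩ := hP.nonempty_mulEquiv h₁ h₂
    exact ⟨φ.trans <| (φ₁.prodCongr φ₂).trans <| MulEquiv.symm
      { Equiv.sumPiEquivProdPi fun i => toggleGroup (Sum.elim Ls₁ Ls₂ i) with
        map_mul' := fun _ _ => rfl }⟩
  prim := Sum.rec F₁.prim F₂.prim
  long := Sum.rec F₁.long F₂.long
  two_le := Sum.rec F₁.two_le F₂.two_le
  coprime := by
    have hcross : ∀ i j, Nat.Coprime (Ls₁ i).card (Ls₂ j).card := fun i j =>
      Nat.Coprime.coprime_dvd_left (F₁.card ▸ Finset.dvd_prod_of_mem _ (Finset.mem_univ i))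
        (Nat.Coprime.coprime_dvd_right
          (F₂.card ▸ Finset.dvd_prod_of_mem _ (Finset.mem_univ j)) hcop)
    rintro (i | i) (j | j) hij
    · exact F₁.coprime i j fun h => hij (h ▸ rfl)
    · exact hcross i j
    · exact (hcross j i).symm
    · exact F₂.coprime i j fun h => hij (h ▸ rfl)
  card := by
    rw [hP.card_eq, F₁.card, F₂.card, Fintype.prod_sum_type]
    rfl

end IsFactorization

/-- A block that is neither small nor everything splits `L` into two coprime factors. -/
lemma IsBlock.exists_isProduct {L : Finset (Finset E)} {U : Finset E} (htrans : IsTransitive L)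
    (hlong : HasLongCycle L) (hU : ∀ X ∈ L, X ⊆ U) {B : Finset {A : Finset E // A ∈ L}}
    (hB : IsBlock L B) (h1 : 1 < B.card) (hne : B ≠ Finset.univ) :
    ∃ L₁ L₂ E₁ E₂, IsProduct L L₁ L₂ E₁ E₂ ∧ E₁ ⊆ U ∧ E₂ ⊆ U ∧ 2 ≤ L₁.card ∧ 2 ≤ L₂.card ∧
      Nat.Coprime L₁.card L₂.card ∧ IsTransitive L₁ ∧ IsTransitive L₂ ∧
      HasLongCycle L₁ ∧ HasLongCycle L₂ := by
  obtain ⟨r, hr, hnt, hnu⟩ := exists_invariant hB h1 hne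
  obtain ⟨L₁, L₂, E₁, E₂, hP, hE₁, hE₂, h₁, h₂⟩ :=
    TogglePaper.exists_isProduct htrans hlong hr hnt hnu hU
  obtain ⟨hl₁, hl₂, hcop⟩ := hP.hasLongCycle_and_coprime h₁ h₂ hlong
  exact ⟨L₁, L₂, E₁, E₂, hP, hE₁, hE₂, h₁, h₂, hcop,
    hP.isTransitive_left (Finset.card_pos.1 (by omega)) htrans,
    hP.symm.isTransitive_left (Finset.card_pos.1 (by omega)) htrans, hl₁, hl₂⟩

/-- A transitive toggle group with a long cycle factors into primitive ones. -/
lemma exists_isFactorization (L : Finset (Finset E)) (U : Finset E) (htrans : IsTransitive L)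
    (hlong : HasLongCycle L) (hcard : 2 ≤ L.card) (hU : ∀ X ∈ L, X ⊆ U) :
    ∃ (ι : Type) (_ : Fintype ι) (_ : Nonempty ι) (Es : ι → Finset E)
      (Ls : ι → Finset (Finset E)), IsFactorization L U Es Ls := by
  induction hn : L.card using Nat.strong_induction_on generalizing L U with
  | _ n ih =>
    subst hn
    by_cases hprim : IsPrimitive L
    · exact ⟨Unit, inferInstance, inferInstance, _, _, .of_isPrimitive hprim hlong hcard hU⟩
    obtain ⟨B, hB, h1, hne⟩ : ∃ B, IsBlock L B ∧ 1 < B.card ∧ B ≠ Finset.univ := by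
      by_contra! h
      exact hprim ⟨htrans, fun B hB => or_iff_not_imp_left.2 fun h' => h B hB (not_le.1 h')⟩
    obtain ⟨L₁, L₂, E₁, E₂, hP, hE₁, hE₂, h₁, h₂, hcop, ht₁, ht₂, hl₁, hl₂⟩ :=
      hB.exists_isProduct htrans hlong hU h1 hne
    have hlt₁ : L₁.card < L.card := by rw [hP.card_eq]; nlinarith
    have hlt₂ : L₂.card < L.card := by rw [hP.card_eq]; nlinarith
    obtain ⟨ι, _, _, Es₁, Ls₁, F₁⟩ := ih _ hlt₁ L₁ E₁ ht₁ hl₁ h₁ hP.sub₁ rfl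
    obtain ⟨κ, _, _, Es₂, Ls₂, F₂⟩ := ih _ hlt₂ L₂ E₂ ht₂ hl₂ h₂ hP.sub₂ rfl
    exact ⟨ι ⊕ κ, inferInstance, inferInstance, _, _, .sum hP hE₁ hE₂
      (Finset.card_pos.1 (by omega)) (Finset.card_pos.1 (by omega)) hcop F₁ F₂⟩

/-- an imprimitive transitive toggle group containing a long cycle is
isomorphic to a direct product of primitive toggle groups, each containing a long
cycle, whose degrees are at least 2, pairwise coprime, and multiply to `|L|`. -/
theorem imprimitive_with_long_cycle_factors_into_primitives
    [Fintype E] (L : Finset (Finset E))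
    (hnt : ∀ e : E, toggle L e ≠ 1)
    (htrans : IsTransitive L)
    (himp : ∃ B : Finset {A : Finset E // A ∈ L},
      IsBlock L B ∧ 1 < B.card ∧ B.card < L.card)
    (hlong : HasLongCycle L) :
    ∃ k : ℕ, 2 ≤ k ∧
      ∃ (Es : Fin k → Finset E) (Ls : Fin k → Finset (Finset E)),
        (∀ i j, i ≠ j → Disjoint (Es i) (Es j)) ∧
        (∀ i, ∀ X ∈ Ls i, X ⊆ Es i) ∧
        (∀ A : Finset E, A ∈ L ↔
          ∃ f : Fin k → Finset E, (∀ i, f i ∈ Ls i) ∧ A = Finset.univ.sup f) ∧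
        Nonempty ((toggleGroup L) ≃* ((i : Fin k) → toggleGroup (Ls i))) ∧
        (∀ i, IsPrimitive (Ls i)) ∧
        (∀ i, HasLongCycle (Ls i)) ∧
        (∀ i, 2 ≤ (Ls i).card) ∧
        (∀ i j, i ≠ j → Nat.Coprime (Ls i).card (Ls j).card) ∧
        L.card = ∏ i, (Ls i).card := by
  obtain ⟨B, hB, h1, hlt⟩ := himp
  have hne : B ≠ Finset.univ := by
    rintro rfl
    simp at hlt
  obtain ⟨L₁, L₂, E₁, E₂, hP, hE₁, hE₂, h₁, h₂, hcop, ht₁, ht₂, hl₁, hl₂⟩ :=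
    hB.exists_isProduct htrans hlong (fun X _ => Finset.subset_univ X) h1 hne
  obtain ⟨ι, _, _, Es₁, Ls₁, F₁⟩ := exists_isFactorization L₁ E₁ ht₁ hl₁ h₁ hP.sub₁
  obtain ⟨κ, _, _, Es₂, Ls₂, F₂⟩ := exists_isFactorization L₂ E₂ ht₂ hl₂ h₂ hP.sub₂
  have F := (IsFactorization.sum hP hE₁ hE₂ (Finset.card_pos.1 (by omega))
    (Finset.card_pos.1 (by omega)) hcop F₁ F₂).reindex (Fintype.equivFin (ι ⊕ κ)).symm
  refine ⟨Fintype.card (ι ⊕ κ), ?_, _, _, F.disj, F.sub, F.mem_iff, F.iso, F.prim, F.long,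
    F.two_le, F.coprime, F.card⟩
  have hι : 0 < Fintype.card ι := Fintype.card_pos
  have hκ : 0 < Fintype.card κ := Fintype.card_pos
  rw [Fintype.card_sum]
  omega

end TogglePaper
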